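/- arXiv:1608.02913 — 5 statements merged into one kernel-verified Lean document; each statement's English description precedes it below -/
import Mathlib

section
/- Let A be a rigid, monoidal-preadditive abelian category in which every monomorphism splits and whose unit object 𝟙 is simple. Then the class Z of zero objects of A is a prime thick tensor ideal of A, and it is the unique one: every thick tensor ideal P of A with 𝟙 ∉ P and such that a ⊗ b ∈ P implies a ∈ P or b ∈ P consists exactly of the zero objects of A. -/
open CategoryTheory CategoryTheory.Limits CategoryTheory.MonoidalCategory

universe v u

/-- A thick tensor ideal of a monoidal abelian category: a class of objects containing the
zero objects, closed under isomorphism, under kernels and cokernels of morphisms between its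
objects, under extensions, and under tensoring with arbitrary objects. -/
structure ThickTensorIdeal (A : Type u) [Category.{v} A] [Abelian A] [MonoidalCategory A] where
  P : A → Prop
  zero_mem : ∀ x : A, IsZero x → P x
  iso_closed : ∀ {a b : A}, (a ≅ b) → P a → P b
  kernel_mem : ∀ {a b : A} (f : a ⟶ b), P a → P b → P (kernel f)
  cokernel_mem : ∀ {a b : A} (f : a ⟶ b), P a → P b → P (cokernel f)
  extension_closed : ∀ (S : ShortComplex A), S.ShortExact → P S.X₁ → P S.X₃ → P S.X₂
  tensor_mem : ∀ {a : A}, P a → ∀ b : A, P (a ⊗ b)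

/-- A thick tensor ideal is prime if it does not contain the unit and
`a ⊗ b ∈ P` implies `a ∈ P` or `b ∈ P`. -/
def ThickTensorIdeal.IsPrime {A : Type u} [Category.{v} A] [Abelian A] [MonoidalCategory A]
    (I : ThickTensorIdeal A) : Prop :=
  ¬ I.P (𝟙_ A) ∧ ∀ a b : A, I.P (a ⊗ b) → I.P a ∨ I.P b

section

variable {A : Type u} [Category.{v} A] [Abelian A] [MonoidalCategory A]

/-- A thick tensor ideal is closed under retracts: a retract is the kernel of an endomorphism. -/
theorem ThickTensorIdeal.mem_of_retract (I : ThickTensorIdeal A) {x y : A} (h : Retract x y)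
    (hy : I.P y) : I.P x := by
  let e : kernel (𝟙 y - h.r ≫ h.i) ≅ x :=
    { hom := kernel.ι _ ≫ h.r
      inv := kernel.lift _ h.i (by simp)
      hom_inv_id := by
        ext
        have := kernel.condition (𝟙 y - h.r ≫ h.i)
        rw [Preadditive.comp_sub, Category.comp_id, sub_eq_zero] at this
        simpa using this.symm
      inv_hom_id := by simp }
  exact I.iso_closed e (I.kernel_mem _ hy hy)

variable [MonoidalPreadditive A]

theorem isZero_tensor_of_left {a : A} (ha : IsZero a) (b : A) : IsZero (a ⊗ b) :=
  (tensorRight b).map_isZero ha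

theorem coevaluation_ne_zero {x : A} [HasRightDual x] (hx : ¬ IsZero x) : η_ x xᘁ ≠ 0 := by
  intro h
  have t := ExactPairing.evaluation_coevaluation x xᘁ
  rw [h, MonoidalPreadditive.zero_whiskerRight, zero_comp] at t
  refine hx ((IsZero.iff_id_eq_zero x).2 ?_)
  calc 𝟙 x = (λ_ x).inv ≫ ((λ_ x).hom ≫ (ρ_ x).inv) ≫ (ρ_ x).hom := by simp
    _ = 0 := by rw [← t]; simp

/-- If monomorphisms split and the unit is simple, the unit is a retract of `x ⊗ xᘁ` for every
nonzero `x`. -/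
theorem nonempty_retract_unit_tensor_rightDual
    (hsplit : ∀ {X Y : A} (f : X ⟶ Y), Mono f → IsSplitMono f)
    [Simple (𝟙_ A)] {x : A} [HasRightDual x] (hx : ¬ IsZero x) :
    Nonempty (Retract (𝟙_ A) (x ⊗ xᘁ)) := by
  have := hsplit (η_ x xᘁ)
    (Preadditive.mono_of_kernel_zero (kernel_zero_of_nonzero_from_simple (coevaluation_ne_zero hx)))
  exact ⟨{ i := η_ x xᘁ, r := retraction (η_ x xᘁ) }⟩

/-- The thick tensor ideal of zero objects. -/
def ThickTensorIdeal.zeroObjects (A : Type u) [Category.{v} A] [Abelian A] [MonoidalCategory A]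
    [MonoidalPreadditive A] : ThickTensorIdeal A where
  P := IsZero
  zero_mem _ h := h
  iso_closed e h := h.of_iso e.symm
  kernel_mem f ha _ := ha.of_mono (kernel.ι f)
  cokernel_mem f _ hb := hb.of_epi (cokernel.π f)
  extension_closed S hS h₁ h₃ := by
    have := hS.exact.mono_g (h₁.eq_of_src _ _)
    exact h₃.of_mono S.g
  tensor_mem ha b := isZero_tensor_of_left ha b

theorem isZero_or_isZero_of_isZero_tensor
    (hsplit : ∀ {X Y : A} (f : X ⟶ Y), Mono f → IsSplitMono f)
    [Simple (𝟙_ A)] {a b : A} [HasRightDual b] (h : IsZero (a ⊗ b)) : IsZero a ∨ IsZero b := by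
  refine or_iff_not_imp_right.2 fun hb => ?_
  obtain ⟨r⟩ := nonempty_retract_unit_tensor_rightDual hsplit hb
  have hz : IsZero (a ⊗ (b ⊗ bᘁ)) := (isZero_tensor_of_left h bᘁ).of_iso (α_ a b bᘁ).symm
  have ha : IsZero (a ⊗ 𝟙_ A) := hz.of_mono (r.map (tensorLeft a)).i
  exact ha.of_iso (ρ_ a).symm

end

/-- In a rigid, monoidal-preadditive abelian category in which every monomorphism splits and
whose unit object is simple, the zero objects form a prime thick tensor ideal, and it is the
unique prime thick tensor ideal. -/
theorem zero_objects_unique_prime_thick_tensor_ideal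
    (A : Type u) [Category.{v} A] [Abelian A] [MonoidalCategory A]
    [MonoidalPreadditive A] [RigidCategory A]
    (hsplit : ∀ {X Y : A} (f : X ⟶ Y), Mono f → IsSplitMono f)
    [Simple (𝟙_ A)] :
    (∃ Z : ThickTensorIdeal A, (∀ x : A, Z.P x ↔ IsZero x) ∧ Z.IsPrime) ∧
      (∀ P : ThickTensorIdeal A, P.IsPrime → ∀ x : A, P.P x ↔ IsZero x) := by
  refine ⟨⟨.zeroObjects A, fun _ => Iff.rfl, Simple.not_isZero _,
    fun a b h => isZero_or_isZero_of_isZero_tensor hsplit h⟩,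
    fun P hP x => ⟨fun hx => ?_, P.zero_mem x⟩⟩
  by_contra hx0
  obtain ⟨r⟩ := nonempty_retract_unit_tensor_rightDual hsplit hx0
  exact hP.1 (P.mem_of_retract r (P.tensor_mem hx xᘁ))
end

section
/- Let A be a rigid, monoidal-preadditive abelian category in which every monomorphism splits and whose unit object 𝟙 is simple. Let P be a class of objects of A that is closed under isomorphism, closed under direct summands, and satisfies: a ∈ P implies a ⊗ b ∈ P for every object b of A. If P contains an object that is not a zero object, then 𝟙 ∈ P. -/
open CategoryTheory CategoryTheory.Limits CategoryTheory.MonoidalCategory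

universe v u

/-- If the coevaluation of an exact pairing vanishes, then the object on its left is zero. -/
theorem isZero_of_coevaluation_eq_zero {C : Type u} [Category.{v} C] [Preadditive C]
    [MonoidalCategory C] [MonoidalPreadditive C] (X Y : C) [ExactPairing X Y]
    (h : η_ X Y = 0) : IsZero X := by
  have key := ExactPairing.evaluation_coevaluation X Y
  rw [h, MonoidalPreadditive.zero_whiskerRight, zero_comp] at key
  rw [IsZero.iff_id_eq_zero]
  calc 𝟙 X = (λ_ X).inv ≫ ((λ_ X).hom ≫ (ρ_ X).inv) ≫ (ρ_ X).hom := by simp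
    _ = 0 := by rw [← key, zero_comp, comp_zero]

/-- Let `A` be a rigid, monoidal-preadditive abelian category in which every monomorphism
splits and whose unit object is simple. If `P` is a class of objects closed under isomorphism,
closed under direct summands (retracts), and closed under tensoring with arbitrary objects,
and `P` contains an object that is not a zero object, then `P` contains the unit object. -/
theorem mem_unit_of_nonzero_mem
    (A : Type u) [Category.{v} A] [Abelian A] [MonoidalCategory A]
    [MonoidalPreadditive A] [RigidCategory A]
    (hsplit : ∀ {X Y : A} (f : X ⟶ Y), Mono f → IsSplitMono f)
    [Simple (𝟙_ A)]
    (P : A → Prop)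
    (hiso : ∀ {a b : A}, (a ≅ b) → P a → P b)
    (hsummand : ∀ {a b : A}, (∃ (i : a ⟶ b) (r : b ⟶ a), i ≫ r = 𝟙 a) → P b → P a)
    (htensor : ∀ {a : A}, P a → ∀ b : A, P (a ⊗ b))
    (hne : ∃ a : A, P a ∧ ¬ IsZero a) :
    P (𝟙_ A) := by
  obtain ⟨a, ha, hnz⟩ := hne
  have hη : η_ a aᘁ ≠ 0 := fun h => hnz (isZero_of_coevaluation_eq_zero a aᘁ h)
  have := hsplit _ (mono_of_nonzero_from_simple hη)
  exact hsummand ⟨η_ a aᘁ, retraction _, IsSplitMono.id _⟩ (htensor ha aᘁ)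
end

section
/- Let A be an abelian category in which every monomorphism splits. Then every cochain complex C over A (indexed by ℤ) is homotopy equivalent to the cochain complex whose n-th term is the cohomology object H^n(C) and all of whose differentials are zero. In particular, in the homotopy category of cochain complexes over A, every complex is isomorphic to the direct sum of its shifted cohomology objects. -/
open CategoryTheory CategoryTheory.Limits

universe v u

/-- The cochain complex whose `n`-th term is the `n`-th cohomology object of `C` and all of
whose differentials are zero. -/
noncomputable def cohomologyComplex {A : Type u} [Category.{v} A] [Abelian A]
    (C : CochainComplex A ℤ) : CochainComplex A ℤ where
  X n := C.homology n
  d _ _ := 0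
  shape _ _ _ := rfl

/-- If every monomorphism splits, then so does every epimorphism. -/
theorem exists_section_of_forall_mono_split
    {A : Type u} [Category.{v} A] [Abelian A]
    (hsplit : ∀ {X Y : A} (f : X ⟶ Y), Mono f → IsSplitMono f)
    {X Y : A} (f : X ⟶ Y) [Epi f] : ∃ s : Y ⟶ X, s ≫ f = 𝟙 Y := by
  have := hsplit (kernel.ι f) inferInstance
  obtain ⟨s, hs⟩ : ∃ s : Y ⟶ X, f ≫ s = 𝟙 X - retraction (kernel.ι f) ≫ kernel.ι f :=
    ⟨Abelian.epiDesc f (𝟙 X - retraction (kernel.ι f) ≫ kernel.ι f) (by simp),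
      Abelian.comp_epiDesc _ _ _⟩
  refine ⟨s, ?_⟩
  rw [← cancel_epi f, reassoc_of% hs]
  simp

/-- If every monomorphism splits, a morphism killed by the second map of an exact sequence
factors through the first one. -/
theorem CategoryTheory.ShortComplex.Exact.exists_lift_of_forall_mono_split
    {A : Type u} [Category.{v} A] [Abelian A]
    (hsplit : ∀ {X Y : A} (f : X ⟶ Y), Mono f → IsSplitMono f)
    {S : ShortComplex A} (hS : S.Exact) {W : A} (k : W ⟶ S.X₂) (hk : k ≫ S.g = 0) :
    ∃ l : W ⟶ S.X₁, l ≫ S.f = k := by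
  have := S.exact_iff_epi_kernel_lift.mp hS
  obtain ⟨s, hs⟩ := exists_section_of_forall_mono_split hsplit (kernel.lift S.g S.f S.zero)
  refine ⟨kernel.lift S.g k hk ≫ s, ?_⟩
  have h := kernel.lift S.g k hk ≫= hs =≫ kernel.ι S.g
  simpa using h

/-- If every monomorphism in the abelian category `A` splits, then every cochain complex over
`A` is homotopy equivalent to the complex of its cohomology objects with zero differentials. -/
theorem homotopyEquiv_cohomologyComplex
    (A : Type u) [Category.{v} A] [Abelian A]
    (hsplit : ∀ {X Y : A} (f : X ⟶ Y), Mono f → IsSplitMono f)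
    (C : CochainComplex A ℤ) :
    Nonempty (HomotopyEquiv C (cohomologyComplex C)) := by
  have hr (n : ℤ) : ∃ r : C.X n ⟶ C.cycles n, C.iCycles n ≫ r = 𝟙 _ :=
    have := hsplit (C.iCycles n) inferInstance
    ⟨retraction (C.iCycles n), IsSplitMono.id _⟩
  choose r hr using hr
  have hdr (i j : ℤ) : C.d i j ≫ r j = C.toCycles i j := by
    rw [← C.toCycles_i i j, Category.assoc, hr, Category.comp_id]
  have hs (n : ℤ) : ∃ s : C.homology n ⟶ C.cycles n, s ≫ C.homologyπ n = 𝟙 _ :=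
    exists_section_of_forall_mono_split hsplit _
  choose s hs using hs
  have hu (i j : ℤ) : ∃ u : C.cycles i ⟶ C.X j,
      ((ComplexShape.up ℤ).Rel j i → u ≫ C.toCycles j i = 𝟙 _ - C.homologyπ i ≫ s i) ∧
      (¬ (ComplexShape.up ℤ).Rel j i → u = 0) := by
    by_cases hij : (ComplexShape.up ℤ).Rel j i
    · have hex : (ShortComplex.mk (C.toCycles j i) (C.homologyπ i) (by simp)).Exact :=
        ShortComplex.exact_of_g_is_cokernel _
          (C.homologyIsCokernel j i ((ComplexShape.up ℤ).prev_eq' hij))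
      obtain ⟨u, hu⟩ := hex.exists_lift_of_forall_mono_split hsplit
        (𝟙 _ - C.homologyπ i ≫ s i) (by simp [hs])
      exact ⟨u, fun _ => hu, fun h => absurd hij h⟩
    · exact ⟨0, fun h => absurd h hij, fun _ => rfl⟩
  choose u hu hu₀ using hu
  let p : C ⟶ cohomologyComplex C :=
    { f n := r n ≫ C.homologyπ n
      comm' i j _ := by
        simp [cohomologyComplex, reassoc_of% hdr] }
  let q : cohomologyComplex C ⟶ C :=
    { f n := s n ≫ C.iCycles n
      comm' i j _ := by simp [cohomologyComplex] }
  have hqp : q ≫ p = 𝟙 _ := by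
    ext n
    change (s n ≫ C.iCycles n) ≫ r n ≫ C.homologyπ n = 𝟙 (C.homology n)
    rw [Category.assoc, reassoc_of% hr, hs]
  -- `𝟙 - toCycles ≫ u` lands in the cycles, so it is killed by `𝟙 - r ≫ iCycles`.
  have htu (i j : ℤ) (hij : (ComplexShape.up ℤ).Rel i j) :
      C.toCycles i j ≫ u j i ≫ (𝟙 _ - r i ≫ C.iCycles i) = 𝟙 _ - r i ≫ C.iCycles i := by
    have hd : (𝟙 _ - C.toCycles i j ≫ u j i) ≫ C.d i j = 0 := by
      rw [← C.toCycles_i i j, ← Category.assoc, Preadditive.sub_comp, Category.assoc,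
        hu j i hij]
      simp
    have hz := C.liftCycles_i _ j ((ComplexShape.up ℤ).next_eq' hij) hd
    have h : (𝟙 _ - C.toCycles i j ≫ u j i) ≫ (𝟙 _ - r i ≫ C.iCycles i) = 0 := by
      rw [← hz, Category.assoc, Preadditive.comp_sub, reassoc_of% hr, Category.comp_id, sub_self,
        comp_zero]
    rw [Preadditive.sub_comp, sub_eq_zero] at h
    simpa using h.symm
  refine ⟨⟨p, q, Homotopy.symm ?_, Homotopy.ofEq hqp⟩⟩
  refine
    { hom i j := r i ≫ u i j ≫ (𝟙 _ - r j ≫ C.iCycles j)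
      zero i j hij := by simp [hu₀ i j hij]
      comm n := ?_ }
  have hn : (ComplexShape.up ℤ).Rel n (n + 1) := rfl
  have hm : (ComplexShape.up ℤ).Rel (n - 1) n := sub_add_cancel n 1
  rw [dNext_eq _ hn, prevD_eq _ hm]
  have hdh : C.d n (n + 1) ≫ r (n + 1) ≫ u (n + 1) n ≫ (𝟙 _ - r n ≫ C.iCycles n) =
      𝟙 _ - r n ≫ C.iCycles n := by
    rw [reassoc_of% hdr, htu n (n + 1) hn]
  have hhd : (r n ≫ u n (n - 1) ≫ (𝟙 _ - r (n - 1) ≫ C.iCycles (n - 1))) ≫ C.d (n - 1) n =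
      r n ≫ C.iCycles n - r n ≫ C.homologyπ n ≫ s n ≫ C.iCycles n := by
    have h := r n ≫= hu n (n - 1) hm =≫ C.iCycles n
    simpa using h
  rw [hdh, hhd]
  have hpq : (p ≫ q).f n = r n ≫ C.homologyπ n ≫ s n ≫ C.iCycles n := Category.assoc _ _ _
  rw [hpq, HomologicalComplex.id_f]
  abel
end

section
/- Let P be a prime ideal of the polynomial ring ℤ[X]. Then P is homogeneous and contains the element 2X if and only if P equals one of the following: the principal ideal (X), the principal ideal (2), or the ideal (X, p) generated by X and p for some prime number p. Here an ideal I is homogeneous if for every f ∈ I and every n ∈ ℕ, the monomial c·Xⁿ lies in I, where c is the coefficient of Xⁿ in f. -/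
open Polynomial

/-- A polynomial lies in `(X, a)` exactly when its constant coefficient is divisible by `a`. -/
theorem mem_span_X_C_iff {R : Type*} [CommRing R] (a : R) (f : R[X]) :
    f ∈ Ideal.span {(X : R[X]), C a} ↔ a ∣ f.coeff 0 := by
  rw [Ideal.mem_span_pair]
  constructor
  · rintro ⟨u, v, rfl⟩
    simp
  · rintro ⟨b, hb⟩
    refine ⟨f.divX, C b, ?_⟩
    conv_rhs => rw [← divX_mul_X_add f, hb]
    rw [mul_comm a b, C_mul]

/-- An ideal containing `X` is determined by its constants. -/
theorem mem_iff_C_coeff_zero_mem {R : Type*} [CommRing R] {P : Ideal R[X]} (hX : X ∈ P)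
    (f : R[X]) : f ∈ P ↔ C (f.coeff 0) ∈ P := by
  conv_lhs => rw [← divX_mul_X_add f]
  exact P.add_mem_iff_right (P.mul_mem_left _ hX)

/-- A prime ideal of `ℤ[X]` containing `X` is `(X)` or `(X, p)` for a prime number `p`. -/
theorem eq_span_X_or_eq_span_X_prime {P : Ideal ℤ[X]} (hP : P.IsPrime) (hX : X ∈ P) :
    P = Ideal.span {(X : ℤ[X])} ∨
      ∃ p : ℕ, p.Prime ∧ P = Ideal.span {(X : ℤ[X]), ((p : ℤ) : ℤ[X])} := by
  have hJ : (P.comap (C : ℤ →+* ℤ[X])).IsPrime := Ideal.comap_isPrime _ _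
  obtain ⟨a, ha⟩ : ∃ a : ℤ, P.comap (C : ℤ →+* ℤ[X]) = Ideal.span {a} :=
    (IsPrincipalIdealRing.principal _).principal
  have hmem : ∀ f, f ∈ P ↔ a ∣ f.coeff 0 := fun f => by
    rw [mem_iff_C_coeff_zero_mem hX, ← Ideal.mem_comap, ha, Ideal.mem_span_singleton]
  rcases eq_or_ne a 0 with rfl | h0
  · left
    ext f
    rw [hmem, Ideal.mem_span_singleton, X_dvd_iff, zero_dvd_iff]
  · right
    rw [ha, Ideal.span_singleton_prime h0] at hJ
    refine ⟨a.natAbs, Int.prime_iff_natAbs_prime.mp hJ, ?_⟩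
    ext f
    rw [hmem, ← eq_intCast (C : ℤ →+* ℤ[X]), mem_span_X_C_iff, Int.natAbs_dvd]

/-- A homogeneous prime ideal of `ℤ[X]` containing `2` but not `X` is `(2)`. -/
theorem eq_span_two_of_X_notMem {P : Ideal ℤ[X]} (hP : P.IsPrime)
    (hom : ∀ f ∈ P, ∀ n : ℕ, (C (f.coeff n) * X ^ n : ℤ[X]) ∈ P)
    (h2 : (2 : ℤ[X]) ∈ P) (hX : X ∉ P) : P = Ideal.span {(2 : ℤ[X])} := by
  refine le_antisymm (fun f hf => ?_) (P.span_singleton_le_iff_mem.mpr h2)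
  rw [Ideal.mem_span_singleton, ← C_ofNat, C_dvd_iff_dvd_coeff]
  intro n
  have hc : C (f.coeff n) ∈ P :=
    (hP.mem_or_mem (hom f hf n)).resolve_right fun h => hX (hP.mem_of_pow_mem n h)
  by_contra hodd
  obtain ⟨k, hk⟩ := Int.not_even_iff_odd.mp (fun h => hodd h.two_dvd)
  refine hP.ne_top (P.eq_top_iff_one.mpr ?_)
  have h1 : (1 : ℤ[X]) = C (f.coeff n) - C k * 2 := by
    rw [hk]
    simp
    ring
  rw [h1]
  exact P.sub_mem hc (P.mul_mem_left _ h2)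

/-- A prime ideal `P` of `ℤ[X]` is homogeneous and contains `2X` if and only if it is `(X)`,
`(2)`, or `(X, p)` for some prime number `p`.  Here an ideal `I` is homogeneous if for every
`f ∈ I` and every `n`, the monomial `C (f.coeff n) * X ^ n` lies in `I`. -/
theorem homogeneous_prime_int_polynomial_containing_two_X
    (P : Ideal (Polynomial ℤ)) (hP : P.IsPrime) :
    ((∀ f ∈ P, ∀ n : ℕ, (C (f.coeff n) * X ^ n : Polynomial ℤ) ∈ P) ∧
        (2 * X : Polynomial ℤ) ∈ P) ↔
      (P = Ideal.span {(X : Polynomial ℤ)} ∨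
        P = Ideal.span {(2 : Polynomial ℤ)} ∨
        ∃ p : ℕ, p.Prime ∧ P = Ideal.span {(X : Polynomial ℤ), ((p : ℤ) : Polynomial ℤ)}) := by
  constructor
  · rintro ⟨hom, h2X⟩
    by_cases hX : X ∈ P
    · exact (eq_span_X_or_eq_span_X_prime hP hX).imp_right Or.inr
    · exact Or.inr (Or.inl (eq_span_two_of_X_notMem hP hom
        ((hP.mem_or_mem h2X).resolve_right hX) hX))
  · intro h
    have of_X_mem (hX : X ∈ P) :
        (∀ f ∈ P, ∀ n : ℕ, (C (f.coeff n) * X ^ n : ℤ[X]) ∈ P) ∧ (2 * X : ℤ[X]) ∈ P := by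
      refine ⟨fun f hf n => ?_, P.mul_mem_left _ hX⟩
      rcases Nat.eq_zero_or_pos n with rfl | hn
      · simpa using (mem_iff_C_coeff_zero_mem hX f).mp hf
      · exact P.mul_mem_left _ (P.pow_mem_of_mem hX n hn)
    rcases h with h | rfl | ⟨p, -, h⟩
    · exact of_X_mem (h ▸ Ideal.mem_span_singleton_self X)
    · refine ⟨fun f hf n => Ideal.mul_mem_right _ _ ?_,
        Ideal.mul_mem_right _ _ (Ideal.mem_span_singleton_self 2)⟩
      rw [Ideal.mem_span_singleton, ← C_ofNat] at hf ⊢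
      exact map_dvd C ((C_dvd_iff_dvd_coeff _ _).mp hf n)
    · exact of_X_mem (h ▸ Ideal.subset_span (Set.mem_insert _ _))
end

section
/- Let p be an odd prime, let R be the localization of ℤ away from p (i.e. ℤ with p inverted), and let S be the quotient ring R[X]/(X² − 1, 2X − 2). Then the only idempotent elements of S are 0 and 1; in particular, 1 is not the sum of two nonzero idempotents of S. -/
open Polynomial

/-- If the kernel of a ring homomorphism to a domain consists of square-zero elements, then the
only idempotents of its source are `0` and `1`. -/
theorem IsIdempotentElem.eq_zero_or_one_of_ker_sq_zero {A B : Type*} [CommRing A] [CommRing B]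
    [IsDomain B] (f : A →+* B) (hf : ∀ x, f x = 0 → x ^ 2 = 0) {s : A}
    (hs : IsIdempotentElem s) : s = 0 ∨ s = 1 := by
  have key : ∀ x : A, IsIdempotentElem x → f x = 0 → x = 0 := fun x hx h => by
    rw [← hx.eq, ← sq, hf x h]
  rcases IsIdempotentElem.iff_eq_zero_or_one.mp (hs.map f) with h | h
  · exact Or.inl (key s hs h)
  · exact Or.inr (sub_eq_zero.mp (key (1 - s) hs.one_sub (by simp [h]))).symm

/-- The only idempotents of `R[X]/(X² − 1, 2X − 2)` are `0` and `1` when `R` is a domain. -/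
theorem Polynomial.eq_zero_or_one_of_isIdempotentElem_quotient {R : Type*} [CommRing R]
    [IsDomain R]
    {s : R[X] ⧸ Ideal.span {(X ^ 2 - 1 : R[X]), (2 * X - 2 : R[X])}}
    (hs : IsIdempotentElem s) : s = 0 ∨ s = 1 := by
  have hI : ∀ g ∈ Ideal.span {(X ^ 2 - 1 : R[X]), (2 * X - 2 : R[X])},
      evalRingHom (1 : R) g = 0 := by
    intro g hg
    refine (Ideal.span_le (I := RingHom.ker (evalRingHom (1 : R)))).mpr ?_ hg
    rintro _ (rfl | rfl) <;> simp [RingHom.mem_ker]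
  refine hs.eq_zero_or_one_of_ker_sq_zero (Ideal.Quotient.lift _ (evalRingHom (1 : R)) hI) ?_
  intro x hx
  obtain ⟨g, rfl⟩ := Ideal.Quotient.mk_surjective x
  rw [Ideal.Quotient.lift_mk, coe_evalRingHom] at hx
  obtain ⟨q, rfl⟩ := dvd_iff_isRoot.mpr hx
  rw [← map_pow, Ideal.Quotient.eq_zero_iff_mem, Ideal.mem_span_pair]
  exact ⟨q ^ 2, -q ^ 2, by rw [C_1]; ring⟩

/-- Let `p` be an odd prime, `R = ℤ[1/p]` the localization of `ℤ` away from `p`, and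
`S = R[X]/(X² − 1, 2X − 2)`.  Then the only idempotents of `S` are `0` and `1`; in particular
`1` is not the sum of two nonzero idempotents of `S`. -/
theorem idempotents_of_localized_GW
    (p : ℕ) (hp : p.Prime) (hodd : Odd p)
    (R : Type*) [CommRing R] [Algebra ℤ R] [IsLocalization.Away ((p : ℕ) : ℤ) R] :
    (∀ s : Polynomial R ⧸
        (Ideal.span {(X ^ 2 - 1 : Polynomial R), (2 * X - 2 : Polynomial R)}),
      IsIdempotentElem s → s = 0 ∨ s = 1) ∧
      ¬ ∃ a b : Polynomial R ⧸
          (Ideal.span {(X ^ 2 - 1 : Polynomial R), (2 * X - 2 : Polynomial R)}),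
        IsIdempotentElem a ∧ IsIdempotentElem b ∧ a ≠ 0 ∧ b ≠ 0 ∧ a + b = 1 := by
  have hp0 : ((p : ℕ) : ℤ) ≠ 0 := Int.natCast_ne_zero.mpr hp.ne_zero
  have : IsDomain R := IsLocalization.isDomain_of_le_nonZeroDivisors R
    (powers_le_nonZeroDivisors_of_noZeroDivisors hp0)
  refine ⟨fun s hs => Polynomial.eq_zero_or_one_of_isIdempotentElem_quotient hs, ?_⟩
  rintro ⟨a, b, ha, -, ha0, hb0, hab⟩
  rcases Polynomial.eq_zero_or_one_of_isIdempotentElem_quotient ha with rfl | rfl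
  · exact ha0 rfl
  · exact hb0 (add_eq_left.mp hab)
end
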